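/- For every stationary measure γ ∈ W: for any positive integer T, ∫_G v_T(y) dγ(y,u) ≤ ∫_G k(y,u) dγ(y,u), and for any ε ∈ (0,1), ∫_G h_ε(y) dγ(y,u) ≤ ∫_G k(y,u) dγ(y,u). -/

import Mathlib

open MeasureTheory Filter Set Topology
open scoped ENNReal NNReal

noncomputable section

namespace StochLP

/-- The model of the controlled stochastic discrete time system (controlled stochastic
recursion) `y(t+1) = f(y(t), u(t), s(t))` from the paper: `Y ⊂ ℝⁿ` is a compact forward
invariant state constraint set, `Uc` is a compact metric control space, `S` is a Polish
noise space, `U` is an upper semicontinuous compact valued control constraint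
multifunction (upper semicontinuity of a compact valued map into a compact space being
recorded as closedness of its graph), `f` is bounded, continuous in `(y,u)` and Borel
measurable in `s`, and `ν` is the common law of the i.i.d. noise elements `s(t)`. -/
structure Model (n : ℕ) (Uc S : Type) [MetricSpace Uc] [CompactSpace Uc]
    [MeasurableSpace Uc] [BorelSpace Uc] [TopologicalSpace S] [PolishSpace S]
    [MeasurableSpace S] [BorelSpace S] where
  Y : Set (Fin n → ℝ)
  U : (Fin n → ℝ) → Set Uc
  f : (Fin n → ℝ) → Uc → S → (Fin n → ℝ)
  ν : Measure S
  ν_prob : IsProbabilityMeasure ν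
  Y_compact : IsCompact Y
  Y_nonempty : Y.Nonempty
  U_nonempty : ∀ y ∈ Y, (U y).Nonempty
  U_compact : ∀ y ∈ Y, IsCompact (U y)
  graph_closed : IsClosed {p : (Fin n → ℝ) × Uc | p.1 ∈ Y ∧ p.2 ∈ U p.1}
  f_bounded : ∃ C : ℝ, ∀ y ∈ Y, ∀ (u : Uc) (s : S), ‖f y u s‖ ≤ C
  f_cont : ∀ s : S, ContinuousOn (fun p : (Fin n → ℝ) × Uc => f p.1 p.2 s) (Y ×ˢ univ)
  f_meas : ∀ y ∈ Y, ∀ u : Uc, Measurable fun s => f y u s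
  f_inv : ∀ y ∈ Y, ∀ u ∈ U y, ∀ s : S, f y u s ∈ Y

variable {n : ℕ} {Uc S : Type} [MetricSpace Uc] [CompactSpace Uc] [MeasurableSpace Uc]
  [BorelSpace Uc] [TopologicalSpace S] [PolishSpace S] [MeasurableSpace S] [BorelSpace S]

/-- A control plan: a sequence of Borel measurable selections of the multifunction `U`. -/
structure Plan (M : Model n Uc S) where
  π : ℕ → (Fin n → ℝ) → Uc
  measurable : ∀ t, Measurable (π t)
  feasible : ∀ t, ∀ y ∈ M.Y, π t y ∈ M.U y

/-- The law of the state `y^{π,y₀}(t)` of the controlled stochastic recursion started at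
`y₀` and driven by the i.i.d. noise with common law `ν`, defined by the Markov recursion.  -/
def stateLaw (M : Model n Uc S) (t : ℕ) :
    (ℕ → (Fin n → ℝ) → Uc) → (Fin n → ℝ) → Measure (Fin n → ℝ) :=
  Nat.rec (motive := fun _ => (ℕ → (Fin n → ℝ) → Uc) → (Fin n → ℝ) → Measure (Fin n → ℝ))
    (fun _ y => Measure.dirac y)
    (fun _ ih π y =>
      (M.ν.map fun s => M.f y (π 0 y) s).bind fun y' => ih (fun j => π (j + 1)) y') t

/-- The joint law of the state-control pair `(y^{π,y₀}(t), u^{π,y₀}(t))`. -/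
def saLaw (M : Model n Uc S) (t : ℕ) (π : ℕ → (Fin n → ℝ) → Uc) (y0 : Fin n → ℝ) :
    Measure ((Fin n → ℝ) × Uc) :=
  (stateLaw M t π y0).map fun z => (z, π t z)

/-- `E[q(y^{π,y₀}(t), u^{π,y₀}(t))]`. -/
def expSA (M : Model n Uc S) (t : ℕ) (π : ℕ → (Fin n → ℝ) → Uc) (y0 : Fin n → ℝ)
    (q : (Fin n → ℝ) → Uc → ℝ) : ℝ :=
  ∫ p, q p.1 p.2 ∂saLaw M t π y0

/-- The finite horizon average expected cost `(1/T) E[Σ_{t=0}^{T-1} k(y(t),u(t))]`. -/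
def costT (M : Model n Uc S) (k : (Fin n → ℝ) → Uc → ℝ) (T : ℕ) (π : ℕ → (Fin n → ℝ) → Uc)
    (y0 : Fin n → ℝ) : ℝ :=
  (1 / (T : ℝ)) * ∑ t ∈ Finset.range T, expSA M t π y0 k

/-- The optimal value `v_T(y₀)` of the finite horizon problem. -/
def vT (M : Model n Uc S) (k : (Fin n → ℝ) → Uc → ℝ) (T : ℕ) (y0 : Fin n → ℝ) : ℝ :=
  ⨅ π : Plan M, costT M k T π.π y0

/-- The expected discounted cost `ε Σ_{t=0}^∞ (1-ε)^t E[k(y(t),u(t))]`. -/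
def costDisc (M : Model n Uc S) (k : (Fin n → ℝ) → Uc → ℝ) (ε : ℝ)
    (π : ℕ → (Fin n → ℝ) → Uc) (y0 : Fin n → ℝ) : ℝ :=
  ε * ∑' t : ℕ, (1 - ε) ^ t * expSA M t π y0 k

/-- The optimal value `h_ε(y₀)` of the discounted problem. -/
def hEps (M : Model n Uc S) (k : (Fin n → ℝ) → Uc → ℝ) (ε : ℝ) (y0 : Fin n → ℝ) : ℝ :=
  ⨅ π : Plan M, costDisc M k ε π.π y0

/-- The graph `G` of the multifunction `U`. -/
def graphG (M : Model n Uc S) : Set ((Fin n → ℝ) × Uc) := {p | p.1 ∈ M.Y ∧ p.2 ∈ M.U p.1}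

/-- `E[φ(f(y,u,s))]`, the expectation over the noise of `φ` evaluated after one step. -/
def Ef (M : Model n Uc S) (φ : (Fin n → ℝ) → ℝ) (y : Fin n → ℝ) (u : Uc) : ℝ :=
  ∫ s, φ (M.f y u s) ∂M.ν

/-- A measure on `Y × Uc` is concentrated on the graph `G` (this encodes measures defined
on Borel subsets of `G`). -/
def onG (M : Model n Uc S) (γ : Measure ((Fin n → ℝ) × Uc)) : Prop := γ (graphG M)ᶜ = 0

/-- The set `W` of stationary measures. -/
def Wset (M : Model n Uc S) : Set (Measure ((Fin n → ℝ) × Uc)) :=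
  {γ | IsProbabilityMeasure γ ∧ onG M γ ∧
    ∀ φ : (Fin n → ℝ) → ℝ, Continuous φ → ∫ p, (Ef M φ p.1 p.2 - φ p.1) ∂γ = 0}

/-- The set `W(ε, y₀)` of discounted stationary measures. -/
def Weps (M : Model n Uc S) (ε : ℝ) (y0 : Fin n → ℝ) : Set (Measure ((Fin n → ℝ) × Uc)) :=
  {γ | IsProbabilityMeasure γ ∧ onG M γ ∧
    ∀ φ : (Fin n → ℝ) → ℝ, Continuous φ →
      ∫ p, ((1 - ε) * (Ef M φ p.1 p.2 - φ p.1) + ε * (φ y0 - φ p.1)) ∂γ = 0}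

/-- The optimal value `k*(ε, y₀)` of the IDLP problem over `W(ε, y₀)`. -/
def kStarEps (M : Model n Uc S) (k : (Fin n → ℝ) → Uc → ℝ) (ε : ℝ) (y0 : Fin n → ℝ) : ℝ :=
  sInf ((fun γ : Measure ((Fin n → ℝ) × Uc) => ∫ p, k p.1 p.2 ∂γ) '' Weps M ε y0)

/-- The optimal value `k*` of the IDLP problem over `W`. -/
def kStar (M : Model n Uc S) (k : (Fin n → ℝ) → Uc → ℝ) : ℝ :=
  sInf ((fun γ : Measure ((Fin n → ℝ) × Uc) => ∫ p, k p.1 p.2 ∂γ) '' Wset M)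

/-- The optimal value `μ*(ε, y₀)` of the problem dual to the IDLP problem over `W(ε,y₀)`. -/
def muStarEps (M : Model n Uc S) (k : (Fin n → ℝ) → Uc → ℝ) (ε : ℝ) (y0 : Fin n → ℝ) : ℝ :=
  sSup {r : ℝ | ∃ ψ : (Fin n → ℝ) → ℝ, Continuous ψ ∧
    r = sInf ((fun p : (Fin n → ℝ) × Uc =>
      k p.1 p.2 + (1 - ε) * (Ef M ψ p.1 p.2 - ψ p.1) + ε * (ψ y0 - ψ p.1)) '' graphG M)}

/-- The optimal value `μ*` of the problem dual to the IDLP problem over `W`. -/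
def muStar (M : Model n Uc S) (k : (Fin n → ℝ) → Uc → ℝ) : ℝ :=
  sSup {r : ℝ | ∃ ψ : (Fin n → ℝ) → ℝ, Continuous ψ ∧
    r = sInf ((fun p : (Fin n → ℝ) × Uc => k p.1 p.2 + Ef M ψ p.1 p.2 - ψ p.1) '' graphG M)}

/-- The feasible set `Ω(y₀)` of the augmented IDLP problem. -/
def OmegaSet (M : Model n Uc S) (y0 : Fin n → ℝ) :
    Set (Measure ((Fin n → ℝ) × Uc) × Measure ((Fin n → ℝ) × Uc)) :=
  {p | p.1 ∈ Wset M ∧ IsFiniteMeasure p.2 ∧ onG M p.2 ∧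
    ∀ φ : (Fin n → ℝ) → ℝ, Continuous φ →
      ∫ q, (φ y0 - φ q.1) ∂p.1 + ∫ q, (Ef M φ q.1 q.2 - φ q.1) ∂p.2 = 0}

/-- The optimal value `k*(y₀)` of the augmented IDLP problem. -/
def kStarAug (M : Model n Uc S) (k : (Fin n → ℝ) → Uc → ℝ) (y0 : Fin n → ℝ) : ℝ :=
  sInf ((fun p : Measure ((Fin n → ℝ) × Uc) × Measure ((Fin n → ℝ) × Uc) =>
    ∫ q, k q.1 q.2 ∂p.1) '' OmegaSet M y0)

/-- Feasibility of `(μ, ψ, η)` for the problem dual to the augmented IDLP problem. -/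
def DualFeas (M : Model n Uc S) (k : (Fin n → ℝ) → Uc → ℝ) (y0 : Fin n → ℝ)
    (ψ η : (Fin n → ℝ) → ℝ) (μ : ℝ) : Prop :=
  (∀ p ∈ graphG M, 0 ≤ k p.1 p.2 + (ψ y0 - ψ p.1) + Ef M η p.1 p.2 - η p.1 - μ) ∧
  (∀ p ∈ graphG M, 0 ≤ Ef M ψ p.1 p.2 - ψ p.1)

/-- The optimal value `d*(y₀)` of the dual (with continuous test functions) of the
augmented IDLP problem. -/
def dStar (M : Model n Uc S) (k : (Fin n → ℝ) → Uc → ℝ) (y0 : Fin n → ℝ) : ℝ :=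
  sSup {μ : ℝ | ∃ ψ η : (Fin n → ℝ) → ℝ, Continuous ψ ∧ Continuous η ∧
    DualFeas M k y0 ψ η μ}

/-- Bounded Borel measurable real valued functions. -/
def BddBorel (ψ : (Fin n → ℝ) → ℝ) : Prop := Measurable ψ ∧ ∃ C : ℝ, ∀ y, |ψ y| ≤ C

/-- The optimal value `d̂*(y₀)` of the relaxed dual (with bounded Borel test functions) of
the augmented IDLP problem. -/
def dHatStar (M : Model n Uc S) (k : (Fin n → ℝ) → Uc → ℝ) (y0 : Fin n → ℝ) : ℝ :=
  sSup {μ : ℝ | ∃ ψ η : (Fin n → ℝ) → ℝ, BddBorel ψ ∧ BddBorel η ∧ DualFeas M k y0 ψ η μ}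

/-- The occupational measure `γ^{π,y₀,T}`. -/
def occT (M : Model n Uc S) (T : ℕ) (π : ℕ → (Fin n → ℝ) → Uc) (y0 : Fin n → ℝ) :
    Measure ((Fin n → ℝ) × Uc) :=
  (T : ℝ≥0∞)⁻¹ • ∑ t ∈ Finset.range T, saLaw M t π y0

/-- The discounted occupational measure `γ_d^{π,y₀,ε}`. -/
def discOcc (M : Model n Uc S) (ε : ℝ) (π : ℕ → (Fin n → ℝ) → Uc) (y0 : Fin n → ℝ) :
    Measure ((Fin n → ℝ) × Uc) :=
  ENNReal.ofReal ε • Measure.sum fun t : ℕ => ENNReal.ofReal (1 - ε) ^ t • saLaw M t π y0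

/-- The set `Θ_ε(y₀)` of discounted occupational measures, as a set of probability
measures (carrying the topology of weak convergence). -/
def ThetaEps (M : Model n Uc S) (ε : ℝ) (y0 : Fin n → ℝ) :
    Set (ProbabilityMeasure ((Fin n → ℝ) × Uc)) :=
  {μ | ∃ π : Plan M, μ.toMeasure = discOcc M ε π.π y0}

/-- `Θ_ε := ∪_{y₀ ∈ Y} Θ_ε(y₀)`. -/
def ThetaEpsAll (M : Model n Uc S) (ε : ℝ) : Set (ProbabilityMeasure ((Fin n → ℝ) × Uc)) :=
  ⋃ y0 ∈ M.Y, ThetaEps M ε y0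

/-- The set `Γ_T(y₀)` of occupational measures. -/
def GammaT (M : Model n Uc S) (T : ℕ) (y0 : Fin n → ℝ) :
    Set (ProbabilityMeasure ((Fin n → ℝ) × Uc)) :=
  {μ | ∃ π : Plan M, μ.toMeasure = occT M T π.π y0}

/-- `Γ_T := ∪_{y₀ ∈ Y} Γ_T(y₀)`. -/
def GammaTAll (M : Model n Uc S) (T : ℕ) : Set (ProbabilityMeasure ((Fin n → ℝ) × Uc)) :=
  ⋃ y0 ∈ M.Y, GammaT M T y0

/-- `W` as a set of probability measures. -/
def WsetPM (M : Model n Uc S) : Set (ProbabilityMeasure ((Fin n → ℝ) × Uc)) :=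
  {μ | μ.toMeasure ∈ Wset M}

/-- `W(ε,y₀)` as a set of probability measures. -/
def WepsPM (M : Model n Uc S) (ε : ℝ) (y0 : Fin n → ℝ) :
    Set (ProbabilityMeasure ((Fin n → ℝ) × Uc)) :=
  {μ | μ.toMeasure ∈ Weps M ε y0}

/-- The set of finite convex combinations of elements of a set of probability measures,
i.e. its convex hull. -/
def convexCombos {α : Type*} [MeasurableSpace α] (A : Set (ProbabilityMeasure α)) :
    Set (ProbabilityMeasure α) :=
  {μ | ∃ (m : ℕ) (w : Fin m → ℝ≥0) (γ : Fin m → ProbabilityMeasure α),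
    (∀ i, γ i ∈ A) ∧ (∑ i, w i) = 1 ∧
    μ.toMeasure = ∑ i, (w i : ℝ≥0∞) • (γ i).toMeasure}

/-- Membership in the set `D₁(y₀)`. -/
def D1mem (M : Model n Uc S) (y0 : Fin n → ℝ) (γ : Measure ((Fin n → ℝ) × Uc)) : Prop :=
  ∃ ξ : ℕ → Measure ((Fin n → ℝ) × Uc),
    (∀ l, IsFiniteMeasure (ξ l) ∧ onG M (ξ l)) ∧
    ∀ φ : (Fin n → ℝ) → ℝ, Continuous φ →
      Tendsto (fun l => ∫ q, (Ef M φ q.1 q.2 - φ q.1) ∂ξ l) atTop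
        (𝓝 (∫ q, (φ q.1 - φ y0) ∂γ))

/-- A control plan is periodic regime generating (PRG) for the initial point `y₀`. -/
def IsPRG (M : Model n Uc S) (π : Plan M) (y0 : Fin n → ℝ) : Prop :=
  ∃ T0 Tp : ℕ, 0 < Tp ∧
    ∀ q : ((Fin n → ℝ) × Uc) → ℝ, Continuous q →
      ∀ t, T0 ≤ t → ∫ p, q p ∂saLaw M t π.π y0 = ∫ p, q p ∂saLaw M (t + Tp) π.π y0

/-- The optimal value `V_per(y₀)` over periodic regime generating control plans. -/
def Vper (M : Model n Uc S) (k : (Fin n → ℝ) → Uc → ℝ) (y0 : Fin n → ℝ) : ℝ :=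
  sInf {c : ℝ | ∃ π : Plan M, IsPRG M π y0 ∧
    Tendsto (fun T => costT M k T π.π y0) atTop (𝓝 c)}

/-- The optimal value `k*_θ(y₀)` of the perturbed augmented IDLP problem. -/
def kStarTheta (M : Model n Uc S) (k θ : (Fin n → ℝ) → Uc → ℝ) (y0 : Fin n → ℝ) : ℝ :=
  sInf ((fun p : Measure ((Fin n → ℝ) × Uc) × Measure ((Fin n → ℝ) × Uc) =>
    ∫ q, k q.1 q.2 ∂p.1 + ∫ q, θ q.1 q.2 ∂p.2) '' OmegaSet M y0)

/-- Feasibility of `(μ, ψ, η)` for the perturbed dual problem. -/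
def DualFeasTheta (M : Model n Uc S) (k θ : (Fin n → ℝ) → Uc → ℝ) (y0 : Fin n → ℝ)
    (ψ η : (Fin n → ℝ) → ℝ) (μ : ℝ) : Prop :=
  (∀ p ∈ graphG M, 0 ≤ k p.1 p.2 + (ψ y0 - ψ p.1) + Ef M η p.1 p.2 - η p.1 - μ) ∧
  (∀ p ∈ graphG M, -θ p.1 p.2 ≤ Ef M ψ p.1 p.2 - ψ p.1)

/-- The optimal value `d*_θ(y₀)` of the perturbed dual problem. -/
def dStarTheta (M : Model n Uc S) (k θ : (Fin n → ℝ) → Uc → ℝ) (y0 : Fin n → ℝ) : ℝ :=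
  sSup {μ : ℝ | ∃ ψ η : (Fin n → ℝ) → ℝ, Continuous ψ ∧ Continuous η ∧
    DualFeasTheta M k θ y0 ψ η μ}

/-- The optimal value `d̄*_θ(y₀)` of the second form of the perturbed dual problem. -/
def dBarTheta (M : Model n Uc S) (k θ : (Fin n → ℝ) → Uc → ℝ) (y0 : Fin n → ℝ) : ℝ :=
  sSup {r : ℝ | ∃ ψ η : (Fin n → ℝ) → ℝ, Continuous ψ ∧ Continuous η ∧ r = ψ y0 ∧
    (∀ p ∈ graphG M, 0 ≤ k p.1 p.2 - ψ p.1 + Ef M η p.1 p.2 - η p.1) ∧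
    (∀ p ∈ graphG M, -θ p.1 p.2 ≤ Ef M ψ p.1 p.2 - ψ p.1)}

section MeasurableSelection

variable {X G : Type*} [MeasurableSpace X]

/-- The closed ball of radius `2⁻ᵗ` around the `i`-th point of a fixed dense sequence. -/
def denseBall (G : Type*) [MetricSpace G] [TopologicalSpace.SeparableSpace G] [Nonempty G]
    (t i : ℕ) : Set G :=
  Metric.closedBall (TopologicalSpace.denseSeq G i) ((1 / 2) ^ t)

variable [MetricSpace G] [TopologicalSpace.SeparableSpace G] [Nonempty G]

lemma exists_inter_denseBall_nonempty {B : Set G} (hB : B.Nonempty) (t : ℕ) :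
    ∃ i, (B ∩ denseBall G t i).Nonempty := by
  obtain ⟨b, hb⟩ := hB
  obtain ⟨i, hi⟩ := (TopologicalSpace.denseRange_denseSeq G).exists_dist_lt b (pow_pos one_half_pos t)
  exact ⟨i, b, hb, hi.le⟩

open Classical in
/-- Intersect `B` with the first ball `denseBall G t i` that it meets. -/
def shrink (t : ℕ) (B : Set G) : Set G :=
  if h : B.Nonempty then B ∩ denseBall G t (Nat.find (exists_inter_denseBall_nonempty h t)) else ∅

lemma shrink_subset (t : ℕ) (B : Set G) : shrink t B ⊆ B := by
  unfold shrink; split_ifs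
  · exact inter_subset_left
  · exact empty_subset _

lemma shrink_nonempty (t : ℕ) {B : Set G} (hB : B.Nonempty) : (shrink t B).Nonempty := by
  classical
  rw [shrink, dif_pos hB]
  exact Nat.find_spec (exists_inter_denseBall_nonempty hB t)

lemma isClosed_shrink (t : ℕ) {B : Set G} (hB : IsClosed B) : IsClosed (shrink t B) := by
  unfold shrink; split_ifs
  · exact hB.inter Metric.isClosed_closedBall
  · exact isClosed_empty

lemma dist_le_of_mem_shrink {t : ℕ} {B : Set G} {a b : G} (ha : a ∈ shrink t B)
    (hb : b ∈ shrink t B) : dist a b ≤ 2 * (1 / 2) ^ t := by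
  unfold shrink at ha hb
  split_ifs at ha hb
  · have := dist_triangle_right a b _ |>.trans (add_le_add ha.2 hb.2)
    linarith
  · exact ha.elim

lemma measurableSet_shrink_inter_nonempty {A : X → Set G} (hne : ∀ x, (A x).Nonempty)
    (hm : ∀ D, IsClosed D → MeasurableSet {x | (A x ∩ D).Nonempty}) (t : ℕ) {D : Set G}
    (hD : IsClosed D) : MeasurableSet {x | (shrink t (A x) ∩ D).Nonempty} := by
  classical
  have hfind : Measurable fun x => Nat.find (exists_inter_denseBall_nonempty (hne x) t) :=
    measurable_find _ fun i => hm _ Metric.isClosed_closedBall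
  have : {x | (shrink t (A x) ∩ D).Nonempty} = ⋃ i,
      {x | Nat.find (exists_inter_denseBall_nonempty (hne x) t) = i} ∩
        {x | (A x ∩ (denseBall G t i ∩ D)).Nonempty} := by
    ext x
    simp [shrink, hne x, inter_assoc]
  rw [this]
  exact .iUnion fun i => (hfind (measurableSet_singleton i)).inter
    (hm _ (Metric.isClosed_closedBall.inter hD))

/-- Kuratowski–Ryll-Nardzewski selection theorem for closed valued multifunctions into a
compact metric space. -/
theorem exists_measurable_selection [CompactSpace G] [MeasurableSpace G] [BorelSpace G]
    {A : X → Set G} (hne : ∀ x, (A x).Nonempty) (hcl : ∀ x, IsClosed (A x))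
    (hm : ∀ D, IsClosed D → MeasurableSet {x | (A x ∩ D).Nonempty}) :
    ∃ σ : X → G, Measurable σ ∧ ∀ x, σ x ∈ A x := by
  let B : ℕ → X → Set G := fun t => Nat.rec A (fun t B x => shrink t (B x)) t
  have hBne : ∀ t x, (B t x).Nonempty := by
    intro t; induction t with
    | zero => exact hne
    | succ t ih => exact fun x => shrink_nonempty t (ih x)
  have hBcl : ∀ t x, IsClosed (B t x) := by
    intro t; induction t with
    | zero => exact hcl
    | succ t ih => exact fun x => isClosed_shrink t (ih x)
  have hBm : ∀ t D, IsClosed D → MeasurableSet {x | (B t x ∩ D).Nonempty} := by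
    intro t; induction t with
    | zero => exact hm
    | succ t ih => exact fun D hD => measurableSet_shrink_inter_nonempty (hBne t) ih t hD
  have hBsub : ∀ t x, B (t + 1) x ⊆ B t x := fun t x => shrink_subset t _
  have hex : ∀ x, (⋂ t, B t x).Nonempty := fun x =>
    IsCompact.nonempty_iInter_of_sequence_nonempty_isCompact_isClosed _ (fun t => hBsub t x)
      (fun t => hBne t x) (hBcl 0 x).isCompact (fun t => hBcl t x)
  choose σ hσ using hex
  simp only [mem_iInter] at hσ
  refine ⟨σ, measurable_of_isClosed fun D hD => ?_, fun x => hσ x 0⟩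
  have : σ ⁻¹' D = ⋂ t, {x | (B t x ∩ D).Nonempty} := by
    ext x
    simp only [mem_preimage, mem_iInter, mem_ofPred_eq]
    refine ⟨fun h t => ⟨σ x, hσ x t, h⟩, fun h => ?_⟩
    obtain ⟨z, hz⟩ := IsCompact.nonempty_iInter_of_sequence_nonempty_isCompact_isClosed
      (fun t => B t x ∩ D) (fun t => inter_subset_inter_left _ (hBsub t x)) h
      ((hBcl 0 x).inter hD).isCompact (fun t => (hBcl t x).inter hD)
    simp only [mem_iInter] at hz
    have hdist : dist (σ x) z ≤ 0 := by
      refine ge_of_tendsto' (f := fun t : ℕ => 2 * (1 / 2 : ℝ) ^ t) (x := atTop) ?_ fun t =>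
        dist_le_of_mem_shrink (hσ x (t + 1)) (hz (t + 1)).1
      simpa using (tendsto_pow_atTop_nhds_zero_of_lt_one (r := (1 / 2 : ℝ)) (by norm_num)
        (by norm_num)).const_mul 2
    rw [dist_le_zero.1 hdist]
    exact (hz 0).2
  rw [this]
  exact .iInter fun t => hBm t D hD

end MeasurableSelection

section FiberMin

variable {X G : Type*} [TopologicalSpace X] [T2Space X] [TopologicalSpace G] [CompactSpace G]
  {p : G → X} {w : G → ℝ≥0∞}

lemma exists_fiber_min (hp : Continuous p) (hw : LowerSemicontinuous w) {D : Set G}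
    (hD : IsClosed D) {x : X} (hx : x ∈ p '' D) :
    ∃ g ∈ D, p g = x ∧ w g = ⨅ g ∈ D ∩ p ⁻¹' {x}, w g := by
  obtain ⟨g, ⟨hgD, hgx⟩, hg⟩ := LowerSemicontinuousOn.exists_isMinOn
    (s := D ∩ p ⁻¹' {x}) hx (hD.inter (isClosed_singleton.preimage hp)).isCompact
    (hw.lowerSemicontinuousOn _)
  exact ⟨g, hgD, hgx, le_antisymm (le_iInf₂ fun g' hg' => hg hg') (iInf₂_le g ⟨hgD, hgx⟩)⟩

lemma lowerSemicontinuous_fiber_min (hp : Continuous p) (hw : LowerSemicontinuous w) {D : Set G}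
    (hD : IsClosed D) : LowerSemicontinuous fun x => ⨅ g ∈ D ∩ p ⁻¹' {x}, w g := by
  rw [lowerSemicontinuous_iff_isClosed_preimage]
  intro c
  rcases eq_or_ne c ⊤ with rfl | hc
  · simp
  have : (fun x => ⨅ g ∈ D ∩ p ⁻¹' {x}, w g) ⁻¹' Iic c = p '' (D ∩ w ⁻¹' Iic c) := by
    ext x
    simp only [mem_preimage, mem_Iic]
    constructor
    · intro h
      by_cases hx : x ∈ p '' D
      · obtain ⟨g, hgD, hgx, hg⟩ := exists_fiber_min hp hw hD hx
        exact ⟨g, ⟨hgD, by simpa [hg] using h⟩, hgx⟩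
      · have : D ∩ p ⁻¹' {x} = ∅ := by
          ext g; simpa using fun hg hgx => hx ⟨g, hg, hgx⟩
        simp [this, hc] at h
    · rintro ⟨g, ⟨hgD, hgc⟩, rfl⟩
      exact (iInf₂_le g ⟨hgD, rfl⟩).trans hgc
  rw [this]
  exact ((hD.inter (hw.isClosed_preimage c)).isCompact.image hp).isClosed

end FiberMin

/-- A lower semicontinuous function on a compact metric space has a Borel measurable selection of
minimizers over the fibers of a continuous surjection. -/
theorem exists_measurable_fiber_argmin {X G : Type*} [TopologicalSpace X] [T2Space X]
    [MeasurableSpace X] [BorelSpace X] [MetricSpace G] [CompactSpace G] [MeasurableSpace G]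
    [BorelSpace G] {p : G → X} (hp : Continuous p) (hsurj : Function.Surjective p)
    {w : G → ℝ≥0∞} (hw : LowerSemicontinuous w) :
    ∃ σ : X → G, Measurable σ ∧ ∀ x, p (σ x) = x ∧ w (σ x) = ⨅ g ∈ p ⁻¹' {x}, w g := by
  rcases isEmpty_or_nonempty X with hX | ⟨⟨x₀⟩⟩
  · exact ⟨fun x => hX.elim x, measurable_of_empty _, fun x => hX.elim x⟩
  have : Nonempty G := ⟨(hsurj x₀).choose⟩
  let m : X → ℝ≥0∞ := fun x => ⨅ g ∈ p ⁻¹' {x}, w g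
  let A : X → Set G := fun x => p ⁻¹' {x} ∩ w ⁻¹' Iic (m x)
  have hA : ∀ x, ∀ g ∈ A x, w g = m x := fun x g hg => le_antisymm hg.2 (iInf₂_le g hg.1)
  have hm : Measurable m := by
    simpa only [univ_inter] using (lowerSemicontinuous_fiber_min hp hw isClosed_univ).measurable
  obtain ⟨σ, hσ, hσA⟩ := exists_measurable_selection (A := A)
    (fun x => by
      obtain ⟨g, -, hgx, hg⟩ := exists_fiber_min hp hw isClosed_univ (x := x)
        (by simpa using hsurj x)
      exact ⟨g, hgx, by simp [hg, m]⟩)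
    (fun x => (isClosed_singleton.preimage hp).inter (hw.isClosed_preimage _))
    (fun D hD => by
      have : {x | (A x ∩ D).Nonempty} =
          p '' D ∩ {x | ⨅ g ∈ D ∩ p ⁻¹' {x}, w g ≤ m x} := by
        ext x
        constructor
        · rintro ⟨g, hg, hgD⟩
          exact ⟨⟨g, hgD, hg.1⟩, le_trans
            (iInf₂_le (f := fun g (_ : g ∈ D ∩ p ⁻¹' {x}) => w g) g ⟨hgD, hg.1⟩) hg.2⟩
        · rintro ⟨hx, hle⟩
          obtain ⟨g, hgD, hgx, hg⟩ := exists_fiber_min hp hw hD hx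
          exact ⟨g, ⟨hgx, hg.trans_le hle⟩, hgD⟩
      rw [this]
      exact (hD.isCompact.image hp).isClosed.measurableSet.inter
        (measurableSet_le (lowerSemicontinuous_fiber_min hp hw hD).measurable hm))
  exact ⟨σ, hσ, fun x => ⟨(hσA x).1, hA x _ (hσA x)⟩⟩

lemma lowerSemicontinuous_lintegral_comp {X G Ω : Type*} [TopologicalSpace X] [MeasurableSpace X]
    [BorelSpace X] [TopologicalSpace G] [FirstCountableTopology G] [MeasurableSpace Ω]
    (μ : Measure Ω) {F : G → Ω → X} (hF : ∀ s, Continuous fun g => F g s)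
    (hFm : ∀ g, Measurable (F g)) {V : X → ℝ≥0∞} (hV : LowerSemicontinuous V) :
    LowerSemicontinuous fun g => ∫⁻ s, V (F g s) ∂μ := by
  refine lowerSemicontinuous_iff_le_liminf.2 fun g => ?_
  calc ∫⁻ s, V (F g s) ∂μ ≤ ∫⁻ s, liminf (fun g' => V (F g' s)) (𝓝 g) ∂μ :=
        lintegral_mono fun s => (hV.comp (hF s)).le_liminf g
    _ ≤ _ := lintegral_liminf_le fun g' => hV.measurable.comp (hFm g')

namespace Model

variable (M : Model n Uc S)

instance : IsProbabilityMeasure M.ν := M.ν_prob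

instance : CompactSpace M.Y := isCompact_iff_compactSpace.1 M.Y_compact

instance : CompactSpace (graphG M) := by
  refine isCompact_iff_compactSpace.1 ?_
  exact (M.Y_compact.prod isCompact_univ).of_isClosed_subset M.graph_closed
    fun p hp => ⟨hp.1, mem_univ _⟩

lemma measurableSet_Y : MeasurableSet M.Y := M.Y_compact.isClosed.measurableSet

lemma measurableSet_graphG : MeasurableSet (graphG M) := M.graph_closed.measurableSet

/-- The state component of a feasible state-control pair. -/
def state (g : graphG M) : M.Y := ⟨g.1.1, g.2.1⟩

lemma continuous_state : Continuous M.state := by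
  unfold state; fun_prop

lemma state_surjective : Function.Surjective M.state := fun y =>
  let ⟨u, hu⟩ := M.U_nonempty y y.2
  ⟨⟨(y, u), y.2, hu⟩, rfl⟩

/-- The successor state of a feasible state-control pair. -/
def next (g : graphG M) (s : S) : M.Y := ⟨M.f g.1.1 g.1.2 s, M.f_inv _ g.2.1 _ g.2.2 s⟩

lemma continuous_next (s : S) : Continuous fun g => M.next g s :=
  ((M.f_cont s).comp_continuous continuous_subtype_val
    fun g : graphG M => ⟨g.2.1, mem_univ _⟩).subtype_mk _

lemma measurable_next (g : graphG M) : Measurable (M.next g) :=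
  (M.f_meas _ g.2.1 _).subtype_mk

lemma measurable_uncurry_next : Measurable (Function.uncurry M.next) :=
  measurable_uncurry_of_continuous_of_measurable M.continuous_next M.measurable_next

end Model

namespace Plan

variable {M : Model n Uc S}

/-- The plan that forgets the first control rule. -/
def tail (P : Plan M) : Plan M where
  π t := P.π (t + 1)
  measurable t := P.measurable (t + 1)
  feasible t := P.feasible (t + 1)

/-- The state-control pair used by a plan at time `t` in a given state. -/
def pair (P : Plan M) (t : ℕ) (y : M.Y) : graphG M := ⟨(y, P.π t y), y.2, P.feasible t y y.2⟩

lemma measurable_pair (P : Plan M) (t : ℕ) : Measurable (P.pair t) :=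
  (measurable_subtype_coe.prodMk ((P.measurable t).comp measurable_subtype_coe)).subtype_mk

/-- A measurable selection of feasible pairs comes from a globally measurable control rule. -/
lemma exists_of_selection {σ : M.Y → graphG M} (hσ : Measurable σ)
    (hσs : ∀ y, M.state (σ y) = y) :
    ∃ τ : (Fin n → ℝ) → Uc, Measurable τ ∧ ∀ y : M.Y, ((y : Fin n → ℝ), τ y) = (σ y).1 := by
  obtain ⟨y₀, hy₀⟩ := M.Y_nonempty
  have : Nonempty Uc := ⟨(M.U_nonempty y₀ hy₀).choose⟩
  obtain ⟨τ, hτ, hτσ⟩ := (MeasurableEmbedding.subtype_coe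
    M.measurableSet_Y).exists_measurable_extend (measurable_snd.comp
      (measurable_subtype_coe.comp hσ)) (fun _ => this)
  exact ⟨τ, hτ, fun y => Prod.ext (congrArg Subtype.val (hσs y)).symm (congrFun hτσ y)⟩

end Plan

section StateLaw

variable {M : Model n Uc S}

lemma stateLaw_succ (t : ℕ) (P : Plan M) (y : Fin n → ℝ) :
    stateLaw M (t + 1) P.π y = (M.ν.map fun s => M.f y (P.π 0 y) s).bind
      fun y' => stateLaw M t P.tail.π y' := rfl

lemma lintegral_stateLaw_succ_of_measurable {t : ℕ} (P : Plan M)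
    (hm : Measurable fun y : M.Y => stateLaw M t P.tail.π y) {q : (Fin n → ℝ) → ℝ≥0∞}
    (hq : Measurable q) (y : M.Y) :
    ∫⁻ z, q z ∂stateLaw M (t + 1) P.π y
      = ∫⁻ s, ∫⁻ z, q z ∂stateLaw M t P.tail.π (M.next (P.pair 0 y) s) ∂M.ν := by
  have hmap : (M.ν.map fun s => M.f y (P.π 0 y) s)
      = (M.ν.map (M.next (P.pair 0 y))).map Subtype.val := by
    rw [Measure.map_map measurable_subtype_coe (M.measurable_next _)]; rfl
  have hemb := MeasurableEmbedding.subtype_coe M.measurableSet_Y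
  have hae : AEMeasurable (fun y' => stateLaw M t P.tail.π y')
      (M.ν.map fun s => M.f y (P.π 0 y) s) := by
    rw [hmap, hemb.aemeasurable_map_iff]
    exact hm.aemeasurable
  rw [stateLaw_succ, Measure.lintegral_bind hae hq.aemeasurable, hmap, hemb.lintegral_map]
  exact lintegral_map ((Measure.measurable_lintegral hq).comp hm) (M.measurable_next _)

lemma measurable_stateLaw (t : ℕ) (P : Plan M) : Measurable fun y : M.Y => stateLaw M t P.π y := by
  induction t generalizing P with
  | zero => exact Measure.measurable_dirac.comp measurable_subtype_coe
  | succ t ih =>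
    refine Measure.measurable_of_measurable_coe _ fun A hA => ?_
    have hA1 : Measurable (A.indicator (1 : (Fin n → ℝ) → ℝ≥0∞)) := measurable_one.indicator hA
    simp_rw [← lintegral_indicator_one hA, lintegral_stateLaw_succ_of_measurable P (ih P.tail) hA1]
    refine Measurable.lintegral_prod_right' (f := fun q : M.Y × S =>
      ∫⁻ z, A.indicator 1 z ∂stateLaw M t P.tail.π (M.next (P.pair 0 q.1) q.2)) ?_
    exact ((Measure.measurable_lintegral hA1).comp (ih P.tail)).comp
      (M.measurable_uncurry_next.comp ((P.measurable_pair 0).prodMap measurable_id))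

lemma lintegral_stateLaw_succ {t : ℕ} (P : Plan M) {q : (Fin n → ℝ) → ℝ≥0∞}
    (hq : Measurable q) (y : M.Y) :
    ∫⁻ z, q z ∂stateLaw M (t + 1) P.π y
      = ∫⁻ s, ∫⁻ z, q z ∂stateLaw M t P.tail.π (M.next (P.pair 0 y) s) ∂M.ν :=
  lintegral_stateLaw_succ_of_measurable P (measurable_stateLaw t P.tail) hq y

instance isProbabilityMeasure_stateLaw (t : ℕ) (P : Plan M) (y : M.Y) :
    IsProbabilityMeasure (stateLaw M t P.π y) := by
  induction t generalizing P y with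
  | zero => exact Measure.dirac.isProbabilityMeasure
  | succ t ih =>
    constructor
    rw [← lintegral_one, lintegral_stateLaw_succ P measurable_const]
    simp

lemma ae_mem_stateLaw (t : ℕ) (P : Plan M) (y : M.Y) : ∀ᵐ z ∂stateLaw M t P.π y, z ∈ M.Y := by
  induction t generalizing P y with
  | zero =>
    exact (ae_dirac_iff M.measurableSet_Y).2 y.2
  | succ t ih =>
    have h1 : Measurable (M.Yᶜ.indicator (1 : (Fin n → ℝ) → ℝ≥0∞)) :=
      measurable_one.indicator M.measurableSet_Y.compl
    have h0 : ∀ y' : M.Y, stateLaw M t P.tail.π y' M.Yᶜ = 0 := fun y' => ih P.tail y'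
    change stateLaw M (t + 1) P.π y M.Yᶜ = 0
    rw [← lintegral_indicator_one M.measurableSet_Y.compl, lintegral_stateLaw_succ P h1]
    simp_rw [lintegral_indicator_one M.measurableSet_Y.compl, h0, lintegral_zero]

end StateLaw

section Bellman

variable (M : Model n Uc S) (q : (Fin n → ℝ) × Uc → ℝ≥0∞) (a : ℝ≥0∞)

/-- The expected total cost over the first `T` steps, with running cost `q` and discount
factor `a`. -/
def totalCost (T : ℕ) (P : Plan M) (y : Fin n → ℝ) : ℝ≥0∞ :=
  ∑ t ∈ Finset.range T, a ^ t * ∫⁻ z, q (z, P.π t z) ∂stateLaw M t P.π y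

/-- The finite horizon value functions, defined by backward dynamic programming. -/
def value : ℕ → M.Y → ℝ≥0∞
  | 0 => 0
  | T + 1 => fun y => ⨅ g ∈ M.state ⁻¹' {y}, (q g.1 + a * ∫⁻ s, value T (M.next g s) ∂M.ν)

variable {M q a}

lemma value_le (T : ℕ) (g : graphG M) :
    value M q a (T + 1) (M.state g) ≤ q g.1 + a * ∫⁻ s, value M q a T (M.next g s) ∂M.ν :=
  iInf₂_le (f := fun g' (_ : g' ∈ M.state ⁻¹' {M.state g}) =>
    q g'.1 + a * ∫⁻ s, value M q a T (M.next g' s) ∂M.ν) g rfl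

lemma lowerSemicontinuous_bellman (hq : LowerSemicontinuous fun g : graphG M => q g.1)
    (ha : a ≠ ⊤) {V : M.Y → ℝ≥0∞} (hV : LowerSemicontinuous V) :
    LowerSemicontinuous fun g : graphG M => q g.1 + a * ∫⁻ s, V (M.next g s) ∂M.ν :=
  hq.add ((ENNReal.continuous_const_mul ha).comp_lowerSemicontinuous
    (lowerSemicontinuous_lintegral_comp M.ν M.continuous_next M.measurable_next hV)
    fun _ _ h => mul_le_mul_right h a)

lemma lowerSemicontinuous_value (hq : LowerSemicontinuous fun g : graphG M => q g.1)
    (ha : a ≠ ⊤) (T : ℕ) : LowerSemicontinuous (value M q a T) := by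
  induction T with
  | zero => exact lowerSemicontinuous_const
  | succ T ih =>
    have := lowerSemicontinuous_fiber_min M.continuous_state
      (lowerSemicontinuous_bellman hq ha ih) isClosed_univ
    simp only [univ_inter] at this
    exact this

lemma totalCost_succ (hq : Measurable q) (T : ℕ) (P : Plan M) (y : M.Y) :
    totalCost M q a (T + 1) P y = q (P.pair 0 y).1
      + a * ∫⁻ s, totalCost M q a T P.tail (M.next (P.pair 0 y) s) ∂M.ν := by
  have hqt : ∀ t (P : Plan M), Measurable fun z => q (z, P.π t z) := fun t P =>
    hq.comp (measurable_id.prodMk (P.measurable t))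
  have hm : ∀ t, Measurable fun s =>
      ∫⁻ z, q (z, P.tail.π t z) ∂stateLaw M t P.tail.π (M.next (P.pair 0 y) s) := fun t =>
    ((Measure.measurable_lintegral (hqt t P.tail)).comp (measurable_stateLaw t P.tail)).comp
      (M.measurable_next _)
  have h0 : ∫⁻ z, q (z, P.π 0 z) ∂stateLaw M 0 P.π y = q (P.pair 0 y).1 :=
    lintegral_dirac' _ (hqt 0 P)
  unfold totalCost
  rw [Finset.sum_range_succ', pow_zero, one_mul, h0, add_comm,
    lintegral_finsetSum _ fun t _ => (hm t).const_mul _, Finset.mul_sum]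
  congr 1
  refine Finset.sum_congr rfl fun t _ => ?_
  rw [lintegral_const_mul _ (hm t), lintegral_stateLaw_succ P (hqt (t + 1) P), pow_succ',
    mul_assoc]
  rfl

lemma value_le_totalCost (hq : Measurable q) (T : ℕ) (P : Plan M) (y : M.Y) :
    value M q a T y ≤ totalCost M q a T P y := by
  induction T generalizing P y with
  | zero => exact zero_le
  | succ T ih =>
    rw [totalCost_succ hq]
    refine (value_le T (P.pair 0 y)).trans ?_
    gcongr
    exact ih _ _

/-- Bellman's optimality principle: some plan is optimal simultaneously for all initial states. -/
lemma exists_totalCost_eq_value (hqm : Measurable q)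
    (hq : LowerSemicontinuous fun g : graphG M => q g.1) (ha : a ≠ ⊤) (T : ℕ) :
    ∃ P : Plan M, ∀ y : M.Y, totalCost M q a T P y = value M q a T y := by
  have hsel : ∀ T, ∃ σ : M.Y → graphG M, ∃ τ : (Fin n → ℝ) → Uc, Measurable τ ∧
      (∀ y : M.Y, ((y : Fin n → ℝ), τ y) = (σ y).1) ∧ ∀ y, value M q a (T + 1) y
        = q (σ y).1 + a * ∫⁻ s, value M q a T (M.next (σ y) s) ∂M.ν := fun T => by
    obtain ⟨σ, hσ, hσm⟩ := exists_measurable_fiber_argmin M.continuous_state M.state_surjective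
      (lowerSemicontinuous_bellman hq ha (lowerSemicontinuous_value hq ha T))
    obtain ⟨τ, hτ, hτσ⟩ := Plan.exists_of_selection hσ fun y => (hσm y).1
    exact ⟨σ, τ, hτ, hτσ, fun y => (hσm y).2.symm⟩
  have hfeas : ∀ {σ : M.Y → graphG M} {τ : (Fin n → ℝ) → Uc},
      (∀ y : M.Y, ((y : Fin n → ℝ), τ y) = (σ y).1) → ∀ y ∈ M.Y, τ y ∈ M.U y :=
    fun {σ τ} h y hy => by
      have := (σ ⟨y, hy⟩).2
      rw [← h ⟨y, hy⟩] at this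
      exact this.2
  induction T with
  | zero =>
    obtain ⟨σ, τ, hτ, hτσ, -⟩ := hsel 0
    exact ⟨⟨fun _ => τ, fun _ => hτ, fun _ => hfeas hτσ⟩, fun y => by simp [totalCost, value]⟩
  | succ T ih =>
    obtain ⟨P, hP⟩ := ih
    obtain ⟨σ, τ, hτ, hτσ, hσ⟩ := hsel T
    let P' : Plan M :=
      { π := fun t => Nat.casesOn t τ P.π
        measurable := fun t => by cases t; exacts [hτ, P.measurable _]
        feasible := fun t => by cases t; exacts [hfeas hτσ, P.feasible _] }
    have hpair : ∀ y, P'.pair 0 y = σ y := fun y => Subtype.ext (hτσ y)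
    have htail : P'.tail = P := rfl
    refine ⟨P', fun y => ?_⟩
    rw [totalCost_succ hqm, hpair, htail, hσ]
    simp_rw [hP]

lemma value_le_sum {B : ℝ≥0∞} (hB : ∀ p, q p ≤ B) (T : ℕ) (y : M.Y) :
    value M q a T y ≤ (∑ t ∈ Finset.range T, a ^ t) * B := by
  induction T generalizing y with
  | zero => simp [value]
  | succ T ih =>
    obtain ⟨g, rfl⟩ := M.state_surjective y
    calc value M q a (T + 1) (M.state g)
        ≤ q g.1 + a * ∫⁻ s, value M q a T (M.next g s) ∂M.ν := value_le T g
      _ ≤ B + a * ∫⁻ _, (∑ t ∈ Finset.range T, a ^ t) * B ∂M.ν := by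
        gcongr with s
        exacts [hB _, ih _]
      _ = _ := by
        simp only [lintegral_const, measure_univ, mul_one]
        rw [Finset.sum_range_succ', pow_zero, add_mul, one_mul, add_comm, ← mul_assoc,
          Finset.mul_sum]
        simp_rw [pow_succ']

end Bellman

section Stationary

variable {M : Model n Uc S} {γ : Measure ((Fin n → ℝ) × Uc)}

lemma map_comap_graphG (hγ : onG M γ) :
    (γ.comap (Subtype.val : graphG M → _)).map Subtype.val = γ := by
  rw [(MeasurableEmbedding.subtype_coe M.measurableSet_graphG).map_comap, Subtype.range_coe,
    Measure.restrict_eq_self_of_ae_mem]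
  exact hγ

lemma isProbabilityMeasure_comap_graphG (hγ : γ ∈ Wset M) :
    IsProbabilityMeasure (γ.comap (Subtype.val : graphG M → _)) := by
  have := hγ.1
  constructor
  rw [← (measure_univ : γ univ = 1), ← preimage_univ (f := (Subtype.val : graphG M → _)),
    ← Measure.map_apply measurable_subtype_coe .univ, map_comap_graphG hγ.2.1]

/-- For a stationary measure, the law of the successor state is the law of the state. -/
lemma map_next_eq_map_state (hγ : γ ∈ Wset M) :
    ((γ.comap (Subtype.val : graphG M → _)).prod M.ν).map (Function.uncurry M.next)
      = (γ.comap (Subtype.val : graphG M → _)).map M.state := by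
  have := isProbabilityMeasure_comap_graphG hγ
  set γ' := γ.comap (Subtype.val : graphG M → _) with hγ'
  have hemb := MeasurableEmbedding.subtype_coe M.measurableSet_Y
  have hmn := M.measurable_uncurry_next
  have hms := M.continuous_state.measurable
  have := Measure.isProbabilityMeasure_map (μ := γ'.prod M.ν) hmn.aemeasurable
  have := Measure.isProbabilityMeasure_map (μ := γ') hms.aemeasurable
  have := Measure.isProbabilityMeasure_map
    (μ := (γ'.prod M.ν).map (Function.uncurry M.next)) measurable_subtype_coe.aemeasurable
  have := Measure.isProbabilityMeasure_map
    (μ := γ'.map M.state) measurable_subtype_coe.aemeasurable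
  refine hemb.map_injective (ext_of_forall_integral_eq_of_IsFiniteMeasure fun φ => ?_)
  have hφm : Measurable fun y : M.Y => φ y := φ.continuous.measurable.comp measurable_subtype_coe
  have hφ : ∀ {Ω : Type _} [MeasurableSpace Ω] (μ : Measure Ω) [IsProbabilityMeasure μ]
      {h : Ω → M.Y}, Measurable h → Integrable (fun ω => φ (h ω)) μ := fun μ _ h hh =>
    Integrable.of_bound (hφm.comp hh).aestronglyMeasurable ‖φ‖
      (.of_forall fun ω => φ.norm_coe_le_norm _)
  have hst := hγ.2.2 φ φ.continuous
  rw [← map_comap_graphG hγ.2.1, ← hγ',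
    (MeasurableEmbedding.subtype_coe M.measurableSet_graphG).integral_map] at hst
  rw [hemb.integral_map, hemb.integral_map,
    integral_map hmn.aemeasurable hφm.aestronglyMeasurable,
    integral_map hms.aemeasurable hφm.aestronglyMeasurable,
    integral_prod _ (hφ _ hmn)]
  have := integral_sub (hφ (γ'.prod M.ν) hmn).integral_prod_left (hφ γ' hms)
  rw [← sub_eq_zero, ← this]
  exact hst

lemma lintegral_value_succ_le {q : (Fin n → ℝ) × Uc → ℝ≥0∞} {a : ℝ≥0∞} (hqm : Measurable q)
    (hq : LowerSemicontinuous fun g : graphG M => q g.1) (ha : a ≠ ⊤)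
    (hγ : γ ∈ Wset M) (T : ℕ) :
    ∫⁻ g, value M q a (T + 1) (M.state g) ∂γ.comap (Subtype.val : graphG M → _)
      ≤ ∫⁻ p, q p ∂γ
        + a * ∫⁻ g, value M q a T (M.state g) ∂γ.comap (Subtype.val : graphG M → _) := by
  have := isProbabilityMeasure_comap_graphG hγ
  have hV := (lowerSemicontinuous_value hq ha T).measurable
  have hV' := hV.comp M.measurable_uncurry_next
  have hγq : ∫⁻ g, q g.1 ∂γ.comap (Subtype.val : graphG M → _) = ∫⁻ p, q p ∂γ := by
    conv_rhs => rw [← map_comap_graphG hγ.2.1]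
    exact (lintegral_map hqm measurable_subtype_coe).symm
  have hnext : ∫⁻ g, ∫⁻ s, value M q a T (M.next g s) ∂M.ν
        ∂γ.comap (Subtype.val : graphG M → _)
      = ∫⁻ g, value M q a T (M.state g) ∂γ.comap (Subtype.val : graphG M → _) := by
    rw [← lintegral_map hV M.continuous_state.measurable, ← map_next_eq_map_state hγ,
      lintegral_map hV M.measurable_uncurry_next]
    exact (lintegral_prod _ hV'.aemeasurable).symm
  have hVn : Measurable fun g => ∫⁻ s, value M q a T (M.next g s) ∂M.ν :=
    hV'.lintegral_prod_right'
  refine (lintegral_mono fun g => value_le T g).trans_eq ?_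
  rw [← hγq, ← hnext, ← lintegral_const_mul _ hVn]
  exact lintegral_add_left (hqm.comp measurable_subtype_coe) _

lemma lintegral_value_le {q : (Fin n → ℝ) × Uc → ℝ≥0∞} {a : ℝ≥0∞} (hqm : Measurable q)
    (hq : LowerSemicontinuous fun g : graphG M => q g.1) (ha : a ≠ ⊤)
    (hγ : γ ∈ Wset M) (T : ℕ) :
    ∫⁻ g, value M q a T (M.state g) ∂γ.comap (Subtype.val : graphG M → _)
      ≤ (∑ t ∈ Finset.range T, a ^ t) * ∫⁻ p, q p ∂γ := by
  induction T with
  | zero => simp [value]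
  | succ T ih =>
    refine (lintegral_value_succ_le hqm hq ha hγ T).trans ((add_le_add_right
      (mul_le_mul_right ih a) _).trans_eq ?_)
    rw [Finset.sum_range_succ', pow_zero, add_mul, one_mul, add_comm, ← mul_assoc,
      Finset.mul_sum]
    simp_rw [pow_succ']

end Stationary

section RealCosts

variable {M : Model n Uc S} {k : (Fin n → ℝ) → Uc → ℝ} {C : ℝ}

/-- The running cost `k + C` on the state constraint set, as an extended nonnegative function. -/
def shiftedCost (M : Model n Uc S) (k : (Fin n → ℝ) → Uc → ℝ) (C : ℝ) :
    (Fin n → ℝ) × Uc → ℝ≥0∞ :=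
  (M.Y ×ˢ univ).indicator fun p => ENNReal.ofReal (k p.1 p.2 + C)

lemma shiftedCost_of_mem {p : (Fin n → ℝ) × Uc} (hp : p.1 ∈ M.Y) :
    shiftedCost M k C p = ENNReal.ofReal (k p.1 p.2 + C) :=
  indicator_of_mem (s := M.Y ×ˢ univ) ⟨hp, mem_univ _⟩ _

lemma continuousOn_shiftedCost
    (hk : ContinuousOn (fun p : (Fin n → ℝ) × Uc => k p.1 p.2) (M.Y ×ˢ (univ : Set Uc))) :
    ContinuousOn (fun p : (Fin n → ℝ) × Uc => ENNReal.ofReal (k p.1 p.2 + C))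
      (M.Y ×ˢ (univ : Set Uc)) :=
  ENNReal.continuous_ofReal.comp_continuousOn (hk.add continuousOn_const)

lemma measurable_shiftedCost
    (hk : ContinuousOn (fun p : (Fin n → ℝ) × Uc => k p.1 p.2) (M.Y ×ˢ (univ : Set Uc))) :
    Measurable (shiftedCost M k C) := by
  classical
  rw [shiftedCost, ← piecewise_eq_indicator]
  exact (continuousOn_shiftedCost hk).measurable_piecewise continuousOn_const
    (M.measurableSet_Y.prod .univ)

lemma lowerSemicontinuous_shiftedCost
    (hk : ContinuousOn (fun p : (Fin n → ℝ) × Uc => k p.1 p.2) (M.Y ×ˢ (univ : Set Uc))) :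
    LowerSemicontinuous fun g : graphG M => shiftedCost M k C g.1 := by
  simp_rw [fun g : graphG M => shiftedCost_of_mem (k := k) (C := C) g.2.1]
  exact ((continuousOn_shiftedCost hk).comp_continuous continuous_subtype_val
    fun g : graphG M => ⟨g.2.1, mem_univ _⟩).lowerSemicontinuous

lemma toReal_shiftedCost (hkC : ∀ y ∈ M.Y, ∀ u : Uc, |k y u| ≤ C) {p : (Fin n → ℝ) × Uc}
    (hp : p.1 ∈ M.Y) : (shiftedCost M k C p).toReal = k p.1 p.2 + C := by
  rw [shiftedCost_of_mem hp, ENNReal.toReal_ofReal]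
  linarith [neg_le_of_abs_le (hkC p.1 hp p.2)]

lemma shiftedCost_le (hkC : ∀ y ∈ M.Y, ∀ u : Uc, |k y u| ≤ C) (p : (Fin n → ℝ) × Uc) :
    shiftedCost M k C p ≤ ENNReal.ofReal (2 * C) := by
  refine indicator_le' (fun p hp => ENNReal.ofReal_le_ofReal ?_) (fun _ _ => zero_le) p
  linarith [le_of_abs_le (hkC p.1 hp.1 p.2)]

lemma Model.nonneg_of_abs_le (hkC : ∀ y ∈ M.Y, ∀ u : Uc, |k y u| ≤ C) : 0 ≤ C :=
  let ⟨y, hy⟩ := M.Y_nonempty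
  (abs_nonneg _).trans (hkC y hy (M.U_nonempty y hy).choose)

lemma lintegral_shiftedCost_le (hkC : ∀ y ∈ M.Y, ∀ u : Uc, |k y u| ≤ C)
    {Ω : Type*} [MeasurableSpace Ω] (μ : Measure Ω) [IsProbabilityMeasure μ]
    (h : Ω → (Fin n → ℝ) × Uc) :
    ∫⁻ ω, shiftedCost M k C (h ω) ∂μ ≤ ENNReal.ofReal (2 * C) :=
  (lintegral_mono fun _ => shiftedCost_le hkC _).trans_eq (by simp)

lemma integral_cost_eq
    (hk : ContinuousOn (fun p : (Fin n → ℝ) × Uc => k p.1 p.2) (M.Y ×ˢ (univ : Set Uc)))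
    (hkC : ∀ y ∈ M.Y, ∀ u : Uc, |k y u| ≤ C) {μ : Measure ((Fin n → ℝ) × Uc)}
    [IsProbabilityMeasure μ] (hμ : ∀ᵐ p ∂μ, p.1 ∈ M.Y) :
    ∫ p, k p.1 p.2 ∂μ = (∫⁻ p, shiftedCost M k C p ∂μ).toReal - C := by
  have hm := measurable_shiftedCost (C := C) hk
  have hint : Integrable (fun p => (shiftedCost M k C p).toReal) μ :=
    integrable_toReal_of_lintegral_ne_top hm.aemeasurable
      ((lintegral_shiftedCost_le hkC μ id).trans_lt ENNReal.ofReal_lt_top).ne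
  rw [← integral_toReal hm.aemeasurable
    (.of_forall fun p => (shiftedCost_le hkC p).trans_lt ENNReal.ofReal_lt_top)]
  calc ∫ p, k p.1 p.2 ∂μ = ∫ p, ((shiftedCost M k C p).toReal - C) ∂μ :=
        integral_congr_ae (hμ.mono fun p hp => by simp [toReal_shiftedCost hkC hp])
    _ = _ := by rw [integral_sub hint (integrable_const C)]; simp

lemma expSA_eq
    (hk : ContinuousOn (fun p : (Fin n → ℝ) × Uc => k p.1 p.2) (M.Y ×ˢ (univ : Set Uc)))
    (hkC : ∀ y ∈ M.Y, ∀ u : Uc, |k y u| ≤ C) (t : ℕ) (P : Plan M) (y : M.Y) :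
    expSA M t P.π y k
      = (∫⁻ z, shiftedCost M k C (z, P.π t z) ∂stateLaw M t P.π y).toReal - C := by
  have hπ : Measurable fun z => (z, P.π t z) := measurable_id.prodMk (P.measurable t)
  have : IsProbabilityMeasure (saLaw M t P.π y) :=
    Measure.isProbabilityMeasure_map hπ.aemeasurable
  have hae : ∀ᵐ p ∂saLaw M t P.π y, p.1 ∈ M.Y :=
    (ae_map_iff hπ.aemeasurable (measurable_fst M.measurableSet_Y)).2 (ae_mem_stateLaw t P y)
  rw [expSA, integral_cost_eq hk hkC hae, saLaw,
    lintegral_map (measurable_shiftedCost hk) hπ]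

lemma toReal_totalCost (hkC : ∀ y ∈ M.Y, ∀ u : Uc, |k y u| ≤ C) {r : ℝ} (hr : 0 ≤ r) (T : ℕ)
    (P : Plan M) (y : M.Y) :
    (totalCost M (shiftedCost M k C) (ENNReal.ofReal r) T P y).toReal = ∑ t ∈ Finset.range T,
      r ^ t * (∫⁻ z, shiftedCost M k C (z, P.π t z) ∂stateLaw M t P.π y).toReal := by
  rw [totalCost, ENNReal.toReal_sum fun t _ => ENNReal.mul_ne_top
    (ENNReal.pow_ne_top ENNReal.ofReal_ne_top)
    ((lintegral_shiftedCost_le hkC _ _).trans_lt ENNReal.ofReal_lt_top).ne]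
  simp [ENNReal.toReal_ofReal hr]

lemma value_ne_top (hkC : ∀ y ∈ M.Y, ∀ u : Uc, |k y u| ≤ C) (r : ℝ) (T : ℕ) (y : M.Y) :
    value M (shiftedCost M k C) (ENNReal.ofReal r) T y ≠ ⊤ :=
  ((value_le_sum (shiftedCost_le hkC) T y).trans_lt (ENNReal.mul_lt_top (ENNReal.sum_lt_top.2
    fun _ _ => ENNReal.pow_lt_top ENNReal.ofReal_lt_top) ENNReal.ofReal_lt_top)).ne

lemma toReal_value_le_totalCost
    (hk : ContinuousOn (fun p : (Fin n → ℝ) × Uc => k p.1 p.2) (M.Y ×ˢ (univ : Set Uc)))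
    (hkC : ∀ y ∈ M.Y, ∀ u : Uc, |k y u| ≤ C) (r : ℝ) (T : ℕ) (P : Plan M) (y : M.Y) :
    (value M (shiftedCost M k C) (ENNReal.ofReal r) T y).toReal
      ≤ (totalCost M (shiftedCost M k C) (ENNReal.ofReal r) T P y).toReal := by
  refine ENNReal.toReal_mono (ENNReal.sum_lt_top.2 fun t _ => ENNReal.mul_lt_top
    (ENNReal.pow_lt_top ENNReal.ofReal_lt_top)
    ((lintegral_shiftedCost_le hkC _ _).trans_lt ENNReal.ofReal_lt_top)).ne
    (value_le_totalCost (measurable_shiftedCost hk) T P y)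

lemma vT_eq
    (hk : ContinuousOn (fun p : (Fin n → ℝ) × Uc => k p.1 p.2) (M.Y ×ˢ (univ : Set Uc)))
    (hkC : ∀ y ∈ M.Y, ∀ u : Uc, |k y u| ≤ C) {T : ℕ} (hT : 1 ≤ T) (y : M.Y) :
    vT M k T y = 1 / T * (value M (shiftedCost M k C) (ENNReal.ofReal 1) T y).toReal - C := by
  have hT0 : (T : ℝ) ≠ 0 := by positivity
  have hcost : ∀ P : Plan M, costT M k T P.π y
      = 1 / T * (totalCost M (shiftedCost M k C) (ENNReal.ofReal 1) T P y).toReal - C := by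
    intro P
    rw [costT, toReal_totalCost hkC zero_le_one]
    simp_rw [expSA_eq hk hkC, Finset.sum_sub_distrib, one_pow, one_mul]
    simp [mul_sub, hT0]
  obtain ⟨P, hP⟩ := exists_totalCost_eq_value (measurable_shiftedCost hk)
    (lowerSemicontinuous_shiftedCost (C := C) hk) (ENNReal.ofReal_ne_top (r := 1)) T
  refine IsLeast.csInf_eq ⟨⟨P, by simp only [hcost, hP]⟩, ?_⟩
  rintro _ ⟨P', rfl⟩
  simp only [hcost]
  exact sub_le_sub_right (mul_le_mul_of_nonneg_left
    (toReal_value_le_totalCost hk hkC 1 T P' y) (by positivity)) C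

lemma costDisc_bounds
    (hk : ContinuousOn (fun p : (Fin n → ℝ) × Uc => k p.1 p.2) (M.Y ×ˢ (univ : Set Uc)))
    (hkC : ∀ y ∈ M.Y, ∀ u : Uc, |k y u| ≤ C) {ε : ℝ} (hε : ε ∈ Ioo (0 : ℝ) 1) (T : ℕ)
    (P : Plan M) (y : M.Y) :
    costDisc M k ε P.π y
      ∈ Icc (ε * (totalCost M (shiftedCost M k C) (ENNReal.ofReal (1 - ε)) T P y).toReal - C)
        (ε * (totalCost M (shiftedCost M k C) (ENNReal.ofReal (1 - ε)) T P y).toReal - C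
          + 2 * C * (1 - ε) ^ T) := by
  have hC := Model.nonneg_of_abs_le hkC
  have hr0 : 0 ≤ 1 - ε := by linarith [hε.2]
  have hr1 : 1 - ε < 1 := by linarith [hε.1]
  rw [toReal_totalCost hkC hr0]
  set r := 1 - ε with hr
  set l : ℕ → ℝ := fun t =>
    (∫⁻ z, shiftedCost M k C (z, P.π t z) ∂stateLaw M t P.π y).toReal with hl
  have hl0 : ∀ t, 0 ≤ l t := fun t => ENNReal.toReal_nonneg
  have hl1 : ∀ t, l t ≤ 2 * C := fun t =>
    ENNReal.toReal_le_of_le_ofReal (by positivity) (lintegral_shiftedCost_le hkC _ _)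
  have hgeo : Summable fun t : ℕ => r ^ t := summable_geometric_of_lt_one hr0 hr1
  have hsum : Summable fun t => r ^ t * l t :=
    Summable.of_nonneg_of_le (fun t => mul_nonneg (pow_nonneg hr0 t) (hl0 t))
      (fun t => mul_le_mul_of_nonneg_left (hl1 t) (pow_nonneg hr0 t)) (hgeo.mul_right _)
  have hεr : ε * ∑' t : ℕ, r ^ t = 1 := by
    rw [tsum_geometric_of_lt_one hr0 hr1, hr, sub_sub_cancel, mul_inv_cancel₀ hε.1.ne']
  have hcost : costDisc M k ε P.π y = ε * ∑' t, r ^ t * l t - C := by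
    simp_rw [costDisc, expSA_eq hk hkC, mul_sub]
    rw [hsum.tsum_sub (hgeo.mul_right C), tsum_mul_right, mul_sub, ← mul_assoc, hεr, one_mul]
  have htail : Summable fun t => r ^ (t + T) * l (t + T) :=
    (summable_nat_add_iff (f := fun t => r ^ t * l t) T).2 hsum
  have htail0 : 0 ≤ ∑' t, r ^ (t + T) * l (t + T) :=
    tsum_nonneg fun t => mul_nonneg (pow_nonneg hr0 _) (hl0 _)
  have htail1 : ∑' t, r ^ (t + T) * l (t + T) ≤ (∑' t : ℕ, r ^ t) * (r ^ T * (2 * C)) := by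
    rw [← tsum_mul_right]
    refine htail.tsum_le_tsum (fun t => ?_) (hgeo.mul_right _)
    rw [pow_add, mul_assoc]
    gcongr
    exact hl1 _
  rw [hcost, ← hsum.sum_add_tsum_nat_add T, mul_add]
  have hlow := mul_nonneg hε.1.le htail0
  have hup := mul_le_mul_of_nonneg_left htail1 hε.1.le
  rw [← mul_assoc, hεr, one_mul] at hup
  constructor <;> linarith

lemma hEps_bounds
    (hk : ContinuousOn (fun p : (Fin n → ℝ) × Uc => k p.1 p.2) (M.Y ×ˢ (univ : Set Uc)))
    (hkC : ∀ y ∈ M.Y, ∀ u : Uc, |k y u| ≤ C) {ε : ℝ} (hε : ε ∈ Ioo (0 : ℝ) 1) (T : ℕ)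
    (y : M.Y) :
    hEps M k ε y
      ∈ Icc (ε * (value M (shiftedCost M k C) (ENNReal.ofReal (1 - ε)) T y).toReal - C)
        (ε * (value M (shiftedCost M k C) (ENNReal.ofReal (1 - ε)) T y).toReal - C
          + 2 * C * (1 - ε) ^ T) := by
  obtain ⟨P, hP⟩ := exists_totalCost_eq_value (measurable_shiftedCost hk)
    (lowerSemicontinuous_shiftedCost (C := C) hk) (ENNReal.ofReal_ne_top (r := 1 - ε)) T
  have : Nonempty (Plan M) := ⟨P⟩
  have hlow : ∀ P' : Plan M,
      ε * (value M (shiftedCost M k C) (ENNReal.ofReal (1 - ε)) T y).toReal - C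
        ≤ costDisc M k ε P'.π y := fun P' => by
    refine le_trans ?_ (costDisc_bounds hk hkC hε T P' y).1
    have := mul_le_mul_of_nonneg_left (toReal_value_le_totalCost hk hkC (1 - ε) T P' y) hε.1.le
    linarith
  refine ⟨le_ciInf hlow, (ciInf_le ⟨_, forall_mem_range.2 hlow⟩ P).trans ?_⟩
  rw [← hP y]
  exact (costDisc_bounds hk hkC hε T P y).2

lemma measurable_value_state
    (hk : ContinuousOn (fun p : (Fin n → ℝ) × Uc => k p.1 p.2) (M.Y ×ˢ (univ : Set Uc)))
    (r : ℝ) (T : ℕ) : Measurable fun g : graphG M =>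
      value M (shiftedCost M k C) (ENNReal.ofReal r) T (M.state g) :=
  (lowerSemicontinuous_value (lowerSemicontinuous_shiftedCost hk)
    ENNReal.ofReal_ne_top T).measurable.comp M.continuous_state.measurable

variable {γ : Measure ((Fin n → ℝ) × Uc)}

lemma lintegral_value_lt_top (hkC : ∀ y ∈ M.Y, ∀ u : Uc, |k y u| ≤ C) (hγ : γ ∈ Wset M)
    (r : ℝ) (T : ℕ) :
    ∫⁻ g, value M (shiftedCost M k C) (ENNReal.ofReal r) T (M.state g)
      ∂γ.comap (Subtype.val : graphG M → _) < ⊤ := by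
  have := isProbabilityMeasure_comap_graphG hγ
  refine (lintegral_mono fun g => value_le_sum (shiftedCost_le hkC) T (M.state g)).trans_lt ?_
  rw [lintegral_const, measure_univ, mul_one]
  exact ENNReal.mul_lt_top (ENNReal.sum_lt_top.2
    fun _ _ => ENNReal.pow_lt_top ENNReal.ofReal_lt_top) ENNReal.ofReal_lt_top

lemma integrable_toReal_value
    (hk : ContinuousOn (fun p : (Fin n → ℝ) × Uc => k p.1 p.2) (M.Y ×ˢ (univ : Set Uc)))
    (hkC : ∀ y ∈ M.Y, ∀ u : Uc, |k y u| ≤ C) (hγ : γ ∈ Wset M) (r : ℝ) (T : ℕ) :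
    Integrable (fun g : graphG M =>
      (value M (shiftedCost M k C) (ENNReal.ofReal r) T (M.state g)).toReal)
      (γ.comap (Subtype.val : graphG M → _)) :=
  integrable_toReal_of_lintegral_ne_top (measurable_value_state hk r T).aemeasurable
    (lintegral_value_lt_top hkC hγ r T).ne

lemma integral_toReal_value_le
    (hk : ContinuousOn (fun p : (Fin n → ℝ) × Uc => k p.1 p.2) (M.Y ×ˢ (univ : Set Uc)))
    (hkC : ∀ y ∈ M.Y, ∀ u : Uc, |k y u| ≤ C) (hγ : γ ∈ Wset M) {r : ℝ} (hr : 0 ≤ r) (T : ℕ) :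
    ∫ g, (value M (shiftedCost M k C) (ENNReal.ofReal r) T (M.state g)).toReal
        ∂γ.comap (Subtype.val : graphG M → _)
      ≤ (∑ t ∈ Finset.range T, r ^ t) * (∫ p, k p.1 p.2 ∂γ + C) := by
  have := hγ.1
  have hqlsc := lowerSemicontinuous_shiftedCost (C := C) hk
  have hae : ∀ᵐ p ∂γ, p.1 ∈ M.Y :=
    (show ∀ᵐ p ∂γ, p ∈ graphG M from hγ.2.1).mono fun p hp => hp.1
  rw [integral_cost_eq hk hkC hae, sub_add_cancel,
    integral_toReal (measurable_value_state hk r T).aemeasurable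
    (.of_forall fun g => (value_ne_top hkC r T _).lt_top)]
  have hsum : (∑ t ∈ Finset.range T, r ^ t)
      = (∑ t ∈ Finset.range T, ENNReal.ofReal r ^ t).toReal := by
    rw [ENNReal.toReal_sum fun _ _ => ENNReal.pow_ne_top ENNReal.ofReal_ne_top]
    simp [ENNReal.toReal_ofReal hr]
  rw [hsum, ← ENNReal.toReal_mul]
  refine ENNReal.toReal_mono (ENNReal.mul_lt_top (ENNReal.sum_lt_top.2
    fun _ _ => ENNReal.pow_lt_top ENNReal.ofReal_lt_top)
      ((lintegral_shiftedCost_le hkC γ id).trans_lt ENNReal.ofReal_lt_top)).ne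
    (lintegral_value_le (measurable_shiftedCost hk) hqlsc ENNReal.ofReal_ne_top hγ T)

lemma integral_state_eq (hγ : γ ∈ Wset M) (F : (Fin n → ℝ) → ℝ) :
    ∫ p, F p.1 ∂γ = ∫ g, F (M.state g) ∂γ.comap (Subtype.val : graphG M → _) := by
  conv_lhs => rw [← map_comap_graphG hγ.2.1]
  exact (MeasurableEmbedding.subtype_coe M.measurableSet_graphG).integral_map _

lemma integral_vT_le
    (hk : ContinuousOn (fun p : (Fin n → ℝ) × Uc => k p.1 p.2) (M.Y ×ˢ (univ : Set Uc)))
    (hkC : ∀ y ∈ M.Y, ∀ u : Uc, |k y u| ≤ C) (hγ : γ ∈ Wset M) {T : ℕ} (hT : 1 ≤ T) :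
    ∫ p, vT M k T p.1 ∂γ ≤ ∫ p, k p.1 p.2 ∂γ := by
  have := isProbabilityMeasure_comap_graphG hγ
  have hT0 : (0 : ℝ) < T := by positivity
  rw [integral_state_eq hγ (vT M k T)]
  simp_rw [vT_eq hk hkC hT]
  rw [integral_sub ((integrable_toReal_value hk hkC hγ 1 T).const_mul _) (integrable_const _),
    integral_const_mul, integral_const, probReal_univ, one_smul]
  have := integral_toReal_value_le hk hkC hγ zero_le_one T
  simp only [one_pow, Finset.sum_const, Finset.card_range, nsmul_eq_mul, mul_one] at this
  rw [sub_le_iff_le_add, one_div, inv_mul_le_iff₀ hT0]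
  exact this

lemma integral_hEps_le
    (hk : ContinuousOn (fun p : (Fin n → ℝ) × Uc => k p.1 p.2) (M.Y ×ˢ (univ : Set Uc)))
    (hkC : ∀ y ∈ M.Y, ∀ u : Uc, |k y u| ≤ C) (hγ : γ ∈ Wset M) {ε : ℝ}
    (hε : ε ∈ Ioo (0 : ℝ) 1) :
    ∫ p, hEps M k ε p.1 ∂γ ≤ ∫ p, k p.1 p.2 ∂γ := by
  have := isProbabilityMeasure_comap_graphG hγ
  have hr0 : 0 ≤ 1 - ε := by linarith [hε.2]
  have hr1 : 1 - ε < 1 := by linarith [hε.1]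
  have hbd := fun T (g : graphG M) => hEps_bounds hk hkC hε T (M.state g)
  have herr : Tendsto (fun T : ℕ => 2 * C * (1 - ε) ^ T) atTop (𝓝 0) := by
    simpa using (tendsto_pow_atTop_nhds_zero_of_lt_one hr0 hr1).const_mul (2 * C)
  have hmeas : Measurable fun g : graphG M => hEps M k ε (M.state g) := by
    refine measurable_of_tendsto_metrizable
      (fun T => ((measurable_value_state (C := C) hk (1 - ε) T).ennreal_toReal.const_mul ε).sub_const C)
      (tendsto_pi_nhds.2 fun g => ?_)
    refine tendsto_iff_dist_tendsto_zero.2 (squeeze_zero (fun _ => dist_nonneg) (fun T => ?_) herr)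
    rw [Real.dist_eq, abs_le]
    constructor <;> linarith [(hbd T g).1, (hbd T g).2, (hbd T g).1.trans (hbd T g).2]
  have hint : Integrable (fun g : graphG M => hEps M k ε (M.state g))
      (γ.comap (Subtype.val : graphG M → _)) := by
    refine Integrable.of_bound hmeas.aestronglyMeasurable C (.of_forall fun g => ?_)
    have := hbd 0 g
    simp only [value, Pi.zero_apply, ENNReal.toReal_zero, mul_zero, pow_zero, mem_Icc] at this
    rw [Real.norm_eq_abs, abs_le]
    constructor <;> linarith [this.1, this.2]
  have hQ : 0 ≤ ∫ p, k p.1 p.2 ∂γ + C := by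
    have := integral_toReal_value_le hk hkC hγ zero_le_one 1
    simp only [Finset.range_one, Finset.sum_singleton, pow_zero, one_mul] at this
    exact (integral_nonneg fun _ => ENNReal.toReal_nonneg).trans this
  rw [integral_state_eq hγ (hEps M k ε)]
  refine ge_of_tendsto' (f := fun T : ℕ => ∫ p, k p.1 p.2 ∂γ + 2 * C * (1 - ε) ^ T)
    (by simpa using herr.const_add _) fun T => ?_
  have hV := integrable_toReal_value hk hkC hγ (1 - ε) T
  have hgeo : ε * ∑ t ∈ Finset.range T, (1 - ε) ^ t ≤ 1 := by
    have := mul_neg_geom_sum (1 - ε) T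
    rw [sub_sub_cancel] at this
    linarith [pow_nonneg hr0 T]
  calc ∫ g, hEps M k ε (M.state g) ∂γ.comap (Subtype.val : graphG M → _)
      ≤ ∫ g, (ε * (value M (shiftedCost M k C) (ENNReal.ofReal (1 - ε)) T (M.state g)).toReal
          + (2 * C * (1 - ε) ^ T - C)) ∂γ.comap (Subtype.val : graphG M → _) :=
        integral_mono hint ((hV.const_mul ε).add (integrable_const _)) fun g => by
          have := (hbd T g).2
          simp only
          linarith
    _ = ε * ∫ g, (value M (shiftedCost M k C) (ENNReal.ofReal (1 - ε)) T (M.state g)).toReal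
          ∂γ.comap (Subtype.val : graphG M → _) + (2 * C * (1 - ε) ^ T - C) := by
        rw [integral_add (hV.const_mul ε) (integrable_const _), integral_const_mul,
          integral_const, probReal_univ, one_smul]
    _ ≤ ε * ((∑ t ∈ Finset.range T, (1 - ε) ^ t) * (∫ p, k p.1 p.2 ∂γ + C))
          + (2 * C * (1 - ε) ^ T - C) := by
        have := hε.1.le
        gcongr
        exact integral_toReal_value_le hk hkC hγ hr0 T
    _ ≤ _ := by
        have := mul_le_mul_of_nonneg_right hgeo hQ
        rw [mul_assoc] at this
        linarith

end RealCosts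

/-- for every stationary measure `γ ∈ W`, `∫ v_T(y) dγ ≤ ∫ k dγ` for any
positive integer `T`, and `∫ h_ε(y) dγ ≤ ∫ k dγ` for any `ε ∈ (0,1)`. -/
theorem statement16 (M : Model n Uc S) (k : (Fin n → ℝ) → Uc → ℝ)
    (hk : ContinuousOn (fun p : (Fin n → ℝ) × Uc => k p.1 p.2) (M.Y ×ˢ (univ : Set Uc)))
    (C : ℝ) (hkC : ∀ y ∈ M.Y, ∀ u : Uc, |k y u| ≤ C)
    (γ : Measure ((Fin n → ℝ) × Uc)) (hγ : γ ∈ Wset M) :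
    (∀ T : ℕ, 1 ≤ T → ∫ p, vT M k T p.1 ∂γ ≤ ∫ p, k p.1 p.2 ∂γ) ∧
    (∀ ε ∈ Set.Ioo (0 : ℝ) 1, ∫ p, hEps M k ε p.1 ∂γ ≤ ∫ p, k p.1 p.2 ∂γ) := by
  exact ⟨fun _ hT => integral_vT_le hk hkC hγ hT, fun _ hε => integral_hEps_le hk hkC hγ hε⟩

end StochLP
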